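/- arXiv:2308.06643 — 9 statements merged into one kernel-verified Lean document; each statement's English description precedes it below -/
import Mathlib

section
/- Let n ≥ 1, let D ⊆ ℂⁿ (identified with the space of functions Fin n → ℂ) be a nonempty open connected set, and let F₁, F₂ : ℂⁿ → ℂ be complex-analytic on D. Suppose there exists a point w ∈ D all of whose coordinates are purely imaginary, and suppose that F₁(z) = F₂(z) for every z ∈ D all of whose coordinates are purely imaginary. Then F₁(z) = F₂(z) for every z ∈ D. -/
open Filter Topology Metric in
/-- The identity theorem in one variable, along the vertical line through the centre of a disc. -/
theorem AnalyticOnNhd.eqOn_ball_of_eq_on_vertical_line {f g : ℂ → ℂ} {c : ℂ} {r : ℝ} (hr : 0 < r)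
    (hf : AnalyticOnNhd ℂ f (ball c r)) (hg : AnalyticOnNhd ℂ g (ball c r))
    (h : ∀ t ∈ ball c r, t.re = c.re → f t = g t) : Set.EqOn f g (ball c r) := by
  refine hf.eqOn_of_preconnected_of_frequently_eq hg (convex_ball c r).isPreconnected
    (mem_ball_self hr) ?_
  have hline : Tendsto (fun s : ℝ ↦ c + s * Complex.I) (𝓝[≠] 0) (𝓝[≠] c) := by
    refine tendsto_nhdsWithin_iff.2 ⟨?_, ?_⟩
    · have hcont : Continuous fun s : ℝ ↦ c + s * Complex.I := by fun_prop
      exact (hcont.tendsto' 0 c (by simp)).mono_left nhdsWithin_le_nhds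
    · filter_upwards [self_mem_nhdsWithin] with s hs
      simpa using hs
  refine hline.frequently (Eventually.frequently ?_)
  filter_upwards [hline (mem_nhdsWithin_of_mem_nhds (ball_mem_nhds c hr))] with s hs
  exact h _ hs (by simp)

/-- Replacing one coordinate is an analytic function of the new value of that coordinate. -/
theorem analyticAt_update {ι : Type*} [Fintype ι] [DecidableEq ι] (z : ι → ℂ) (a : ι) (t : ℂ) :
    AnalyticAt ℂ (Function.update z a) t := by
  refine AnalyticAt.pi fun j ↦ ?_
  by_cases hj : j = a
  · subst hj
    simpa only [Function.update_self] using! (analyticAt_id : AnalyticAt ℂ (id : ℂ → ℂ) t)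
  · simpa [hj] using analyticAt_const

open Metric in
/-- Two functions analytic on a polydisc which agree at the points of the polydisc having the same
real parts as the centre agree on the whole polydisc. -/
theorem AnalyticOnNhd.eqOn_ball_of_eq_of_re_eq {ι : Type*} [Fintype ι] {f g : (ι → ℂ) → ℂ}
    {w : ι → ℂ} {r : ℝ} (hr : 0 < r)
    (hf : AnalyticOnNhd ℂ f (ball w r)) (hg : AnalyticOnNhd ℂ g (ball w r))
    (h : ∀ z ∈ ball w r, (∀ j, (z j).re = (w j).re) → f z = g z) :
    Set.EqOn f g (ball w r) := by
  classical
  suffices H : ∀ S : Finset ι, ∀ z ∈ ball w r, (∀ j ∉ S, (z j).re = (w j).re) → f z = g z from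
    fun z hz ↦ H Finset.univ z hz (by simp)
  intro S
  induction S using Finset.induction_on with
  | empty => exact fun z hz hre ↦ h z hz fun j ↦ hre j (Finset.notMem_empty j)
  | insert a S _ ih =>
    intro z hz hre
    have hmem : ∀ t ∈ ball (w a) r, Function.update z a t ∈ ball w r := by
      intro t ht
      rw [mem_ball, dist_pi_lt_iff hr] at hz ⊢
      intro j
      by_cases hj : j = a
      · subst hj
        simpa using ht
      · simpa [hj] using hz j
    have hza : z a ∈ ball (w a) r := (dist_pi_lt_iff hr).1 hz a
    have key := AnalyticOnNhd.eqOn_ball_of_eq_on_vertical_line hr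
      (f := f ∘ Function.update z a) (g := g ∘ Function.update z a)
      (fun t ht ↦ (hf _ (hmem t ht)).comp (analyticAt_update z a t))
      (fun t ht ↦ (hg _ (hmem t ht)).comp (analyticAt_update z a t))
      (fun t ht hta ↦ ih _ (hmem t ht) fun j hj ↦ ?_) hza
    · simpa using key
    · by_cases hja : j = a
      · subst hja
        simpa using hta
      · simpa [hja] using hre j (by simp [hja, hj])

/-- **Identity theorem for several complex variables** (Lemma 4.2 of the paper):
if two functions analytic on a nonempty open connected set `D ⊆ ℂⁿ` coincide on the
purely imaginary points of `D` (and `D` contains such a point), then they coincide on `D`. -/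
theorem stmt_0 (n : ℕ) (hn : 1 ≤ n) (D : Set (Fin n → ℂ))
    (hD : IsOpen D) (hDconn : IsConnected D)
    (F₁ F₂ : (Fin n → ℂ) → ℂ)
    (hF₁ : AnalyticOnNhd ℂ F₁ D) (hF₂ : AnalyticOnNhd ℂ F₂ D)
    (w : Fin n → ℂ) (hw : w ∈ D) (hwim : ∀ j, (w j).re = 0)
    (heq : ∀ z ∈ D, (∀ j, (z j).re = 0) → F₁ z = F₂ z) :
    ∀ z ∈ D, F₁ z = F₂ z := by
  obtain ⟨r, hr, hball⟩ := Metric.isOpen_iff.1 hD w hw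
  have hloc : Set.EqOn F₁ F₂ (Metric.ball w r) :=
    AnalyticOnNhd.eqOn_ball_of_eq_of_re_eq hr (hF₁.mono hball) (hF₂.mono hball)
      fun z hz hre ↦ heq z (hball hz) fun j ↦ (hre j).trans (hwim j)
  exact hF₁.eqOn_of_preconnected_of_eventuallyEq hF₂ hDconn.isPreconnected hw
    (hloc.eventuallyEq_of_mem (Metric.ball_mem_nhds w hr))
end

section
/- There exist an open set U ⊆ ℂ⁶ containing 0, an open set V ⊆ ℂ⁸ containing the point (√−1, …, √−1), and a map z* : U → ℂ⁸ which is complex-analytic on U, such that: z*(0) = (√−1, …, √−1); for every H = (H₁,…,H₆) ∈ U the point z*(H) = (z₁,z₂,z₃,z₄,z̃₁,z̃₂,z̃₃,z̃₄) lies in V, each of its eight coordinates lies in ℂ∖{0,1}, and it satisfies the eight equations F_{e₁} = 2π√−1, F_{e₂} = 2π√−1, and F_{m_l} = H_l for l = 1,…,6; and moreover, for every H ∈ U, z*(H) is the unique point of V whose coordinates all lie in ℂ∖{0,1} satisfying these eight equations. -/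
open Complex

/-- `w' = 1/(1-w)` -/
noncomputable def sp (w : ℂ) : ℂ := 1 / (1 - w)

/-- `w'' = 1 - 1/w` -/
noncomputable def spp (w : ℂ) : ℂ := 1 - 1 / w

/-- The coordinates of `z : Fin 8 → ℂ` are `(z₁,z₂,z₃,z₄,z̃₁,z̃₂,z̃₃,z̃₄)`. -/
noncomputable def Fe₁ (z : Fin 8 → ℂ) : ℂ :=
  log (z 0) + log (z 1) + log (z 2) + log (z 3)

noncomputable def Fe₂ (z : Fin 8 → ℂ) : ℂ :=
  log (z 4) + log (z 5) + log (z 6) + log (z 7)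

noncomputable def Fm₁ (z : Fin 8 → ℂ) : ℂ :=
  log (z 3) + log (z 7) - log (spp (z 2)) - log (sp (z 0)) - log (spp (z 4)) - log (sp (z 6))

noncomputable def Fm₂ (z : Fin 8 → ℂ) : ℂ :=
  log (sp (z 3)) + log (spp (z 7)) - log (sp (z 0)) - log (spp (z 4))

noncomputable def Fm₃ (z : Fin 8 → ℂ) : ℂ :=
  log (spp (z 0)) + log (sp (z 4)) - log (spp (z 1)) - log (sp (z 5))

noncomputable def Fm₄ (z : Fin 8 → ℂ) : ℂ :=
  log (z 2) + log (z 6) - log (spp (z 3)) - log (sp (z 1)) - log (spp (z 5)) - log (sp (z 7))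

noncomputable def Fm₅ (z : Fin 8 → ℂ) : ℂ :=
  log (sp (z 1)) + log (spp (z 5)) - log (sp (z 2)) - log (spp (z 6))

noncomputable def Fm₆ (z : Fin 8 → ℂ) : ℂ :=
  log (spp (z 3)) + log (sp (z 7)) - log (spp (z 2)) - log (sp (z 6))

/-- The eight gluing equations of the ideal triangulation of a `D`-block,
with prescribed logarithmic holonomies `H = (H₁,…,H₆)`. -/
noncomputable def GluingEqs (H : Fin 6 → ℂ) (z : Fin 8 → ℂ) : Prop :=
  Fe₁ z = 2 * (Real.pi : ℂ) * I ∧ Fe₂ z = 2 * (Real.pi : ℂ) * I ∧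
  Fm₁ z = H 0 ∧ Fm₂ z = H 1 ∧ Fm₃ z = H 2 ∧ Fm₄ z = H 3 ∧ Fm₅ z = H 4 ∧ Fm₆ z = H 5

open scoped ContDiff Topology

lemma hasStrictDerivAt_log_I : HasStrictDerivAt log (-I) I := by
  simpa using hasStrictDerivAt_log (x := I) (by simp [mem_slitPlane_iff])

lemma sp_I : sp I = (1 + I) / 2 := by
  have h : (1 - I : ℂ) ≠ 0 := fun h => by simpa using congrArg re h
  rw [sp, div_eq_div_iff h two_ne_zero]
  linear_combination I_sq

lemma spp_I : spp I = 1 + I := by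
  simp [spp]

lemma hasDerivAt_sp_I : HasDerivAt sp (I / 2) I := by
  have h : (1 - I : ℂ) ≠ 0 := fun h => by simpa using congrArg re h
  have := ((hasDerivAt_id I).const_sub 1).inv h
  refine (this.congr_deriv ?_).congr_of_eventuallyEq (.of_forall fun w => by simp [sp])
  rw [id, div_eq_div_iff (pow_ne_zero 2 h) two_ne_zero]
  linear_combination (2 - I) * I_sq

lemma hasDerivAt_spp_I : HasDerivAt spp (-1) I := by
  have := (hasDerivAt_inv I_ne_zero).const_sub 1
  refine (this.congr_deriv ?_).congr_of_eventuallyEq (.of_forall fun w => by simp [spp])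
  simp

lemma sp_I_mem_slitPlane : sp I ∈ slitPlane := by
  rw [sp_I, mem_slitPlane_iff]; left; simp

lemma spp_I_mem_slitPlane : spp I ∈ slitPlane := by
  rw [spp_I, mem_slitPlane_iff]; left; simp

lemma hasDerivAt_log_sp_I : HasDerivAt (fun w => log (sp w)) ((1 + I) / 2) I := by
  refine (hasDerivAt_sp_I.clog sp_I_mem_slitPlane).congr_deriv ?_
  rw [div_eq_iff (slitPlane_ne_zero sp_I_mem_slitPlane), sp_I]
  linear_combination -I_sq / 4

lemma hasDerivAt_log_spp_I : HasDerivAt (fun w => log (spp w)) ((-1 + I) / 2) I := by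
  refine (hasDerivAt_spp_I.clog spp_I_mem_slitPlane).congr_deriv ?_
  rw [div_eq_iff (slitPlane_ne_zero spp_I_mem_slitPlane), spp_I]
  linear_combination -I_sq / 2

lemma contDiffAt_log_sp_I : ContDiffAt ℂ ω (fun w => log (sp w)) I := by
  have h : (1 - I : ℂ) ≠ 0 := fun h => by simpa using congrArg re h
  refine (contDiffAt_log sp_I_mem_slitPlane).comp I ?_
  exact contDiffAt_const.div (contDiffAt_const.sub contDiffAt_id) h

lemma contDiffAt_log_spp_I : ContDiffAt ℂ ω (fun w => log (spp w)) I := by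
  refine (contDiffAt_log spp_I_mem_slitPlane).comp I ?_
  exact contDiffAt_const.sub (contDiffAt_const.div contDiffAt_id I_ne_zero)

lemma log_I_add_log_I : log I + log I = Real.pi * I := by
  rw [log_I]; ring

lemma log_sp_I_add_log_spp_I : log (sp I) + log (spp I) = log I := by
  have h : sp I * spp I = I := by
    rw [sp_I, spp_I]; linear_combination I_sq / 2
  have hsp : |(sp I).arg| < Real.pi / 2 := by
    rw [abs_arg_lt_pi_div_two_iff, sp_I]; left; simp
  have hspp : |(spp I).arg| < Real.pi / 2 := by
    rw [abs_arg_lt_pi_div_two_iff, spp_I]; left; simp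
  rw [abs_lt] at hsp hspp
  rw [← log_mul (slitPlane_ne_zero sp_I_mem_slitPlane) (slitPlane_ne_zero spp_I_mem_slitPlane)
    ⟨by linarith, by linarith⟩, h]

/-- The eight edge and holonomy functions, as a single map. -/
noncomputable def gluingMap (z : Fin 8 → ℂ) : Fin 8 → ℂ :=
  ![Fe₁ z, Fe₂ z, Fm₁ z, Fm₂ z, Fm₃ z, Fm₄ z, Fm₅ z, Fm₆ z]

/-- The values prescribed for `gluingMap` by the gluing equations. -/
noncomputable def gluingTarget (H : Fin 6 → ℂ) : Fin 8 → ℂ :=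
  ![2 * (Real.pi : ℂ) * I, 2 * (Real.pi : ℂ) * I, H 0, H 1, H 2, H 3, H 4, H 5]

lemma gluingEqs_iff (H : Fin 6 → ℂ) (z : Fin 8 → ℂ) :
    GluingEqs H z ↔ gluingMap z = gluingTarget H := by
  simp [GluingEqs, gluingMap, gluingTarget, funext_iff, Fin.forall_fin_succ]

lemma gluingMap_I : gluingMap (fun _ => I) = gluingTarget 0 := by
  rw [← gluingEqs_iff]
  have h₁ := log_I_add_log_I
  have h₂ := log_sp_I_add_log_spp_I
  simp only [GluingEqs, Fe₁, Fe₂, Fm₁, Fm₂, Fm₃, Fm₄, Fm₅, Fm₆, Pi.zero_apply]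
  refine ⟨?_, ?_, ?_, ?_, ?_, ?_, ?_, ?_⟩
  · linear_combination 2 * h₁
  · linear_combination 2 * h₁
  · linear_combination -2 * h₂
  · ring
  · ring
  · linear_combination -2 * h₂
  · ring
  · ring

lemma analyticAt_gluingTarget (H : Fin 6 → ℂ) : AnalyticAt ℂ gluingTarget H := by
  rw [analyticAt_pi_iff]
  have h (i : Fin 6) : AnalyticAt ℂ (fun H : Fin 6 → ℂ => H i) H :=
    (ContinuousLinearMap.proj (R := ℂ) (φ := fun _ : Fin 6 => ℂ) i).analyticAt H
  intro i
  fin_cases i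
  exacts [analyticAt_const, analyticAt_const, h 0, h 1, h 2, h 3, h 4, h 5]

lemma contDiffAt_gluingMap : ContDiffAt ℂ ω gluingMap (fun _ => I) := by
  have hp (i : Fin 8) : ContDiffAt ℂ ω (fun z : Fin 8 → ℂ => z i) (fun _ => I) :=
    contDiffAt_apply ..
  have hl (i : Fin 8) : ContDiffAt ℂ ω (fun z : Fin 8 → ℂ => log (z i)) (fun _ => I) :=
    (contDiffAt_log (by simp [mem_slitPlane_iff])).comp (fun _ : Fin 8 => I) (hp i)
  have hs (i : Fin 8) : ContDiffAt ℂ ω (fun z : Fin 8 → ℂ => log (sp (z i))) (fun _ => I) :=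
    ContDiffAt.comp (g := fun w => log (sp w)) (fun _ : Fin 8 => I)
      contDiffAt_log_sp_I (hp i)
  have ht (i : Fin 8) : ContDiffAt ℂ ω (fun z : Fin 8 → ℂ => log (spp (z i))) (fun _ => I) :=
    ContDiffAt.comp (g := fun w => log (spp w)) (fun _ : Fin 8 => I)
      contDiffAt_log_spp_I (hp i)
  rw [contDiffAt_pi]
  intro i
  fin_cases i
  · exact (((hl 0).add (hl 1)).add (hl 2)).add (hl 3)
  · exact (((hl 4).add (hl 5)).add (hl 6)).add (hl 7)
  · exact (((((hl 3).add (hl 7)).sub (ht 2)).sub (hs 0)).sub (ht 4)).sub (hs 6)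
  · exact (((hs 3).add (ht 7)).sub (hs 0)).sub (ht 4)
  · exact (((ht 0).add (hs 4)).sub (ht 1)).sub (hs 5)
  · exact (((((hl 2).add (hl 6)).sub (ht 3)).sub (hs 1)).sub (ht 5)).sub (hs 7)
  · exact (((hs 1).add (ht 5)).sub (hs 2)).sub (ht 6)
  · exact (((ht 3).add (hs 7)).sub (ht 2)).sub (hs 6)

/-- The linear map whose shape is that of the derivative of `gluingMap` at a point with equal
coordinates, where `a`, `b`, `c` are the logarithmic derivatives of `w`, `w'`, `w''`. -/
noncomputable def gluingDeriv (a b c : ℂ) : (Fin 8 → ℂ) →L[ℂ] (Fin 8 → ℂ) :=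
  let p (i : Fin 8) : (Fin 8 → ℂ) →L[ℂ] ℂ := ContinuousLinearMap.proj i
  ContinuousLinearMap.pi
    ![a • p 0 + a • p 1 + a • p 2 + a • p 3,
      a • p 4 + a • p 5 + a • p 6 + a • p 7,
      a • p 3 + a • p 7 - c • p 2 - b • p 0 - c • p 4 - b • p 6,
      b • p 3 + c • p 7 - b • p 0 - c • p 4,
      c • p 0 + b • p 4 - c • p 1 - b • p 5,
      a • p 2 + a • p 6 - c • p 3 - b • p 1 - c • p 5 - b • p 7,
      b • p 1 + c • p 5 - b • p 2 - c • p 6,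
      c • p 3 + b • p 7 - c • p 2 - b • p 6]

lemma hasFDerivAt_gluingMap :
    HasFDerivAt gluingMap (gluingDeriv (-I) ((1 + I) / 2) ((-1 + I) / 2)) (fun _ => I) := by
  have hp (i : Fin 8) : HasFDerivAt (fun z : Fin 8 → ℂ => z i)
      (ContinuousLinearMap.proj (R := ℂ) (φ := fun _ : Fin 8 => ℂ) i) (fun _ => I) :=
    hasFDerivAt_apply i _
  have hl (i : Fin 8) := hasStrictDerivAt_log_I.hasDerivAt.comp_hasFDerivAt (fun _ => I) (hp i)
  have hs (i : Fin 8) := hasDerivAt_log_sp_I.comp_hasFDerivAt (fun _ => I) (hp i)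
  have ht (i : Fin 8) := hasDerivAt_log_spp_I.comp_hasFDerivAt (fun _ => I) (hp i)
  refine hasFDerivAt_pi.2 fun i => ?_
  fin_cases i
  · exact (((hl 0).add (hl 1)).add (hl 2)).add (hl 3)
  · exact (((hl 4).add (hl 5)).add (hl 6)).add (hl 7)
  · exact (((((hl 3).add (hl 7)).sub (ht 2)).sub (hs 0)).sub (ht 4)).sub (hs 6)
  · exact (((hs 3).add (ht 7)).sub (hs 0)).sub (ht 4)
  · exact (((ht 0).add (hs 4)).sub (ht 1)).sub (hs 5)
  · exact (((((hl 2).add (hl 6)).sub (ht 3)).sub (hs 1)).sub (ht 5)).sub (hs 7)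
  · exact (((hs 1).add (ht 5)).sub (hs 2)).sub (ht 6)
  · exact (((ht 3).add (hs 7)).sub (ht 2)).sub (hs 6)

lemma gluingDeriv_injective {a b c : ℂ} (ha : a ≠ 0) (hsum : a + b + c = 0) (hbc : b ≠ c) :
    Function.Injective (gluingDeriv a b c) := by
  rw [injective_iff_map_eq_zero]
  intro x hx
  obtain rfl : a = -(b + c) := by linear_combination hsum
  have hbc' : (b + c) * (b - c) ≠ 0 :=
    mul_ne_zero (neg_ne_zero.1 ha) (sub_ne_zero.2 hbc)
  have uv {s t : ℂ} (hu : b * s + c * t = 0) (hv : c * s + b * t = 0) : s = 0 ∧ t = 0 :=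
    ⟨(mul_eq_zero.1 (by linear_combination b * hu - c * hv :
        (b + c) * (b - c) * s = 0)).resolve_left hbc',
      (mul_eq_zero.1 (by linear_combination b * hv - c * hu :
        (b + c) * (b - c) * t = 0)).resolve_left hbc'⟩
  simp only [gluingDeriv, funext_iff, Fin.forall_fin_succ] at hx
  simp at hx
  obtain ⟨e₁, e₂, m₁, m₂, m₃, m₄, m₅, m₆⟩ := hx
  have hX : x 0 + x 1 + x 2 + x 3 = 0 :=
    (mul_eq_zero.1 (by linear_combination e₁ :
      -(b + c) * (x 0 + x 1 + x 2 + x 3) = 0)).resolve_left ha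
  have hY : x 4 + x 5 + x 6 + x 7 = 0 :=
    (mul_eq_zero.1 (by linear_combination e₂ :
      -(b + c) * (x 4 + x 5 + x 6 + x 7) = 0)).resolve_left ha
  have v₃ : c * x 2 + b * x 6 = 0 := by
    linear_combination -(m₁ + m₄ + (b * hX + c * hY) + 2 * m₆) / 4
  have v₄ : c * x 3 + b * x 7 = 0 := by linear_combination v₃ + m₆
  have u₁ : b * x 0 + c * x 4 = 0 := by linear_combination -(m₁ + m₂ + m₆ + 2 * v₃) / 2
  have u₄ : b * x 3 + c * x 7 = 0 := by linear_combination u₁ + m₂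
  have u₂ : b * x 1 + c * x 5 = 0 := by linear_combination (m₅ - m₄ - m₆ - 2 * v₃) / 2
  have u₃ : b * x 2 + c * x 6 = 0 := by linear_combination u₂ - m₅
  have v₁ : c * x 0 + b * x 4 = 0 := by
    linear_combination ((c * hX + b * hY) + m₃ - v₃ - v₄) / 2
  have v₂ : c * x 1 + b * x 5 = 0 := by linear_combination v₁ - m₃
  ext i
  fin_cases i
  exacts [(uv u₁ v₁).1, (uv u₂ v₂).1, (uv u₃ v₃).1, (uv u₄ v₄).1,
    (uv u₁ v₁).2, (uv u₂ v₂).2, (uv u₃ v₃).2, (uv u₄ v₄).2]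

lemma exists_equiv_hasFDerivAt_gluingMap :
    ∃ L : (Fin 8 → ℂ) ≃L[ℂ] (Fin 8 → ℂ),
      HasFDerivAt gluingMap (L : (Fin 8 → ℂ) →L[ℂ] (Fin 8 → ℂ)) (fun _ => I) := by
  have hinj : Function.Injective (gluingDeriv (-I) ((1 + I) / 2) ((-1 + I) / 2)) := by
    refine gluingDeriv_injective (neg_ne_zero.2 I_ne_zero) (by ring) fun h => ?_
    simpa using (by linear_combination h : (1 : ℂ) = 0)
  refine ⟨(LinearEquiv.ofInjectiveEndo _ hinj).toContinuousLinearEquiv, ?_⟩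
  convert hasFDerivAt_gluingMap using 1
  rfl

/-- **Existence, uniqueness, and analyticity of the solution of the gluing equations of a
`D`-block near the complete structure** (Proposition 3.1 of the paper). -/
theorem stmt_1 :
    ∃ (U : Set (Fin 6 → ℂ)) (V : Set (Fin 8 → ℂ)) (zstar : (Fin 6 → ℂ) → (Fin 8 → ℂ)),
      IsOpen U ∧ (0 : Fin 6 → ℂ) ∈ U ∧
      IsOpen V ∧ (fun _ => I : Fin 8 → ℂ) ∈ V ∧
      AnalyticOnNhd ℂ zstar U ∧
      zstar 0 = (fun _ => I : Fin 8 → ℂ) ∧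
      (∀ H ∈ U, zstar H ∈ V ∧ (∀ i, zstar H i ≠ 0 ∧ zstar H i ≠ 1) ∧ GluingEqs H (zstar H)) ∧
      (∀ H ∈ U, ∀ y ∈ V, (∀ i, y i ≠ 0 ∧ y i ≠ 1) → GluingEqs H y → y = zstar H) := by
  obtain ⟨L, hL⟩ := exists_equiv_hasFDerivAt_gluingMap
  let Φ := contDiffAt_gluingMap.toOpenPartialHomeomorph gluingMap hL (by simp)
  have hΦ : ⇑Φ = gluingMap := rfl
  have hIV : (fun _ => I : Fin 8 → ℂ) ∈ Φ.source :=
    contDiffAt_gluingMap.mem_toOpenPartialHomeomorph_source hL (by simp)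
  have hsymm : Φ.symm (gluingTarget 0) = fun _ => I := by
    rw [← gluingMap_I, ← hΦ]; exact Φ.left_inv hIV
  have hmem : gluingTarget 0 ∈ Φ.target := by
    rw [← gluingMap_I]; exact Φ.map_source hIV
  have hana : AnalyticAt ℂ Φ.symm (gluingTarget 0) := by
    rw [← gluingMap_I]
    exact (contDiffAt_gluingMap.to_localInverse hL (by simp)).analyticAt
  have hne : ∀ᶠ w in 𝓝 (gluingTarget 0), ∀ i, Φ.symm w i ≠ 0 ∧ Φ.symm w i ≠ 1 := by
    refine Filter.eventually_all.2 fun i => ?_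
    have hc : ContinuousAt (fun w => Φ.symm w i) (gluingTarget 0) :=
      (continuous_apply i).continuousAt.comp hana.continuousAt
    have h1 : I ≠ 1 := fun h => by simpa using congrArg re h
    exact (hc.eventually_ne (by simp [hsymm])).and (hc.eventually_ne (by simpa [hsymm] using h1))
  have hev := (Φ.open_target.eventually_mem hmem).and (hana.eventually_analyticAt.and hne)
  obtain ⟨W, hW, hWo, h0W⟩ := eventually_nhds_iff.1 hev
  have hcont : Continuous gluingTarget :=
    continuous_iff_continuousAt.2 fun H => (analyticAt_gluingTarget H).continuousAt
  refine ⟨gluingTarget ⁻¹' W, Φ.source, fun H => Φ.symm (gluingTarget H),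
    hWo.preimage hcont, h0W, Φ.open_source, hIV, fun H hH => ?_, hsymm, fun H hH => ?_,
    fun H hH y hy _ hyH => ?_⟩
  · exact (hW _ hH).2.1.comp (analyticAt_gluingTarget H)
  · exact ⟨Φ.map_target (hW _ hH).1, (hW _ hH).2.2,
      (gluingEqs_iff _ _).2 (Φ.right_inv (hW _ hH).1)⟩
  · beta_reduce
    rw [← (gluingEqs_iff _ _).1 hyH]
    exact (Φ.left_inv hy).symm
end

section
/- Let u₁,…,u₆ ∈ ℂ be nonzero, let A, B, C be as defined below, and let z ∈ ℂ satisfy Az² + Bz + C = 0. Assume the eight complex numbers z + u₂u₃u₄, z·u₁u₃u₅ + u₁u₂u₄u₅, z·u₁u₆ + u₂, z·u₁ + u₂u₆, z·u₃u₄ − u₂²u₃u₄, z·u₁u₅ − u₂u₄, z·u₁ − u₂u₄u₅, and z·u₂u₆ − u₂u₆ are all nonzero. Define z₁* = (z − u₂²)/(z + u₂u₃u₄), z₂* = (z·u₁u₃u₅ − u₂u₃u₄)/(z·u₁u₃u₅ + u₁u₂u₄u₅), z₃* = (z·u₁u₆ − u₂u₄u₅u₆)/(z·u₁u₆ + u₂),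 z₄* = (z·u₁ − u₁)/(z·u₁ + u₂u₆), z̃₁* = −(z·u₂ + u₂²u₃u₄)/(z·u₃u₄ − u₂²u₃u₄), z̃₂* = −(z·u₃ + u₂u₄)/(z·u₁u₅ − u₂u₄), z̃₃* = −(z·u₁u₄u₅u₆ + u₂u₄u₅)/(z·u₁ − u₂u₄u₅), z̃₄* = −(z·u₁ + u₂u₆)/(z·u₂u₆ − u₂u₆). Then z₁*·z₂*·z₃*·z₄* = 1 and z̃₁*·z̃₂*·z̃₃*·z̃₄* = 1. -/
/-- The coefficient `A` of the quadratic equation of a `D`-block. -/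
noncomputable def qA (u₁ u₂ u₃ u₄ u₅ u₆ : ℂ) : ℂ :=
  - u₁/u₄ - u₁*u₃/u₂ - u₁/(u₂*u₃) - u₁/(u₂^2*u₄) - u₅/u₂ - u₆/(u₂*u₄)
    - 1/(u₂*u₄*u₆) - 1/(u₂*u₅)

/-- The coefficient `B` of the quadratic equation of a `D`-block. -/
noncomputable def qB (u₁ u₂ u₃ u₄ u₅ u₆ : ℂ) : ℂ :=
  - u₁*u₄ + u₁/u₄ + u₄/u₁ - 1/(u₁*u₄)
    + u₂*u₅ + u₂/u₅ + u₅/u₂ + 1/(u₂*u₅)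
    - u₃*u₆ - u₃/u₆ - u₆/u₃ - 1/(u₃*u₆)

/-- The coefficient `C` of the quadratic equation of a `D`-block. -/
noncomputable def qC (u₁ u₂ u₃ u₄ u₅ u₆ : ℂ) : ℂ :=
  - u₄/u₁ - u₂/(u₁*u₃) - u₂*u₃/u₁ - u₂^2*u₄/u₁ - u₂/u₅ - u₂*u₄/u₆ - u₂*u₄*u₆ - u₂*u₅

/-- The difference of numerator and denominator of the first edge equation is a multiple of
the quadratic polynomial `A z² + B z + C`. -/
theorem edge_numerator_sub_denominator (u₁ u₂ u₃ u₄ u₅ u₆ z : ℂ)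
    (h₁ : u₁ ≠ 0) (h₂ : u₂ ≠ 0) (h₃ : u₃ ≠ 0) (h₄ : u₄ ≠ 0) (h₅ : u₅ ≠ 0) (h₆ : u₆ ≠ 0) :
    (z - u₂^2) * (z*u₁*u₃*u₅ - u₂*u₃*u₄) * (z*u₁*u₆ - u₂*u₄*u₅*u₆) * (z*u₁ - u₁)
      - (z + u₂*u₃*u₄) * (z*u₁*u₃*u₅ + u₁*u₂*u₄*u₅) * (z*u₁*u₆ + u₂) * (z*u₁ + u₂*u₆)
    = z * u₁^2 * u₂^2 * u₃ * u₄ * u₅ * u₆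
      * (qA u₁ u₂ u₃ u₄ u₅ u₆ * z^2 + qB u₁ u₂ u₃ u₄ u₅ u₆ * z + qC u₁ u₂ u₃ u₄ u₅ u₆) := by
  unfold qA qB qC
  field_simp
  ring

/-- **The explicit solution of the gluing equations of a `D`-block satisfies the two
exponentiated edge equations** `z₁*z₂*z₃*z₄* = 1` and `z̃₁*z̃₂*z̃₃*z̃₄* = 1`. -/
theorem stmt_3 (u₁ u₂ u₃ u₄ u₅ u₆ z : ℂ)
    (h₁ : u₁ ≠ 0) (h₂ : u₂ ≠ 0) (h₃ : u₃ ≠ 0) (h₄ : u₄ ≠ 0) (h₅ : u₅ ≠ 0) (h₆ : u₆ ≠ 0)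
    (hz : qA u₁ u₂ u₃ u₄ u₅ u₆ * z^2 + qB u₁ u₂ u₃ u₄ u₅ u₆ * z + qC u₁ u₂ u₃ u₄ u₅ u₆ = 0)
    (hd₁ : z + u₂*u₃*u₄ ≠ 0)
    (hd₂ : z*u₁*u₃*u₅ + u₁*u₂*u₄*u₅ ≠ 0)
    (hd₃ : z*u₁*u₆ + u₂ ≠ 0)
    (hd₄ : z*u₁ + u₂*u₆ ≠ 0)
    (hd₅ : z*u₃*u₄ - u₂^2*u₃*u₄ ≠ 0)
    (hd₆ : z*u₁*u₅ - u₂*u₄ ≠ 0)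
    (hd₇ : z*u₁ - u₂*u₄*u₅ ≠ 0)
    (hd₈ : z*u₂*u₆ - u₂*u₆ ≠ 0) :
    ((z - u₂^2)/(z + u₂*u₃*u₄))
      * ((z*u₁*u₃*u₅ - u₂*u₃*u₄)/(z*u₁*u₃*u₅ + u₁*u₂*u₄*u₅))
      * ((z*u₁*u₆ - u₂*u₄*u₅*u₆)/(z*u₁*u₆ + u₂))
      * ((z*u₁ - u₁)/(z*u₁ + u₂*u₆)) = 1
    ∧ (-((z*u₂ + u₂^2*u₃*u₄)/(z*u₃*u₄ - u₂^2*u₃*u₄)))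
      * (-((z*u₃ + u₂*u₄)/(z*u₁*u₅ - u₂*u₄)))
      * (-((z*u₁*u₄*u₅*u₆ + u₂*u₄*u₅)/(z*u₁ - u₂*u₄*u₅)))
      * (-((z*u₁ + u₂*u₆)/(z*u₂*u₆ - u₂*u₆))) = 1 := by
  have key := edge_numerator_sub_denominator u₁ u₂ u₃ u₄ u₅ u₆ z h₁ h₂ h₃ h₄ h₅ h₆
  rw [hz, mul_zero, sub_eq_zero] at key
  constructor
  · rw [div_mul_div_comm, div_mul_div_comm, div_mul_div_comm, key]
    exact div_self (mul_ne_zero (mul_ne_zero (mul_ne_zero hd₁ hd₂) hd₃) hd₄)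
  · simp only [neg_mul, mul_neg, neg_neg]
    rw [div_mul_div_comm, div_mul_div_comm, div_mul_div_comm,
      div_eq_one_iff_eq (mul_ne_zero (mul_ne_zero (mul_ne_zero hd₅ hd₆) hd₇) hd₈)]
    apply mul_left_cancel₀ h₁
    linear_combination (-(u₂ * u₄)) * key
end

section
/- Let u₁,…,u₆ ∈ ℂ be nonzero, let A, B, C be as defined below, and let z ∈ ℂ satisfy Az² + Bz + C = 0. Define z₁* = (z − u₂²)/(z + u₂u₃u₄), z₂* = (z·u₁u₃u₅ − u₂u₃u₄)/(z·u₁u₃u₅ + u₁u₂u₄u₅), z₃* = (z·u₁u₆ − u₂u₄u₅u₆)/(z·u₁u₆ + u₂), z₄* = (z·u₁ − u₁)/(z·u₁ + u₂u₆), z̃₁* = −(z·u₂ + u₂²u₃u₄)/(z·u₃u₄ − u₂²u₃u₄), z̃₂* = −(z·u₃ + u₂u₄)/(z·u₁u₅ − u₂u₄), z̃₃* = −(z·u₁u₄u₅u₆ + u₂u₄u₅)/(z·u₁ − u₂u₄u₅), z̃₄* = −(z·u₁ + u₂u₆)/(z·u₂u₆ − u₂u₆), and assume all eight displayed denominators are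 nonzero and each of the eight values z₁*,…,z̃₄* lies in ℂ∖{0,1}. For w ∈ ℂ∖{0,1} write w' = 1/(1−w) and w'' = 1 − 1/w. Then the following six identities hold: z₄*·z̃₄* = u₁²·(z₃*)''·(z₁*)'·(z̃₁*)''·(z̃₃*)'; (z₄*)'·(z̃₄*)'' = u₂²·(z₁*)'·(z̃₁*)''; (z₁*)''·(z̃₁*)' = u₃²·(z₂*)''·(z̃₂*)'; z₃*·z̃₃* = u₄²·(z₄*)''·(z₂*)'·(z̃₂*)''·(z̃₄*)'; (z₂*)'·(z̃₂*)'' = u₅²·(z₃*)'·(z̃₃*)''; (z₄*)''·(z̃₄*)' = u₆²·(z₃*)''·(z̃₃*)'. -/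
/-- The product of `1 - 1/x` and `1/(1-y)` for `x = a/b` and `y = -(c/d)`. -/
lemma spp_mul_sp_of_eq_div {a b c d x y : ℂ} (hd : d ≠ 0)
    (hx : x = a / b) (hy : y = -(c / d)) (hx₀ : x ≠ 0) (hy₁ : y ≠ 1) {p q : ℂ} (hq : q ≠ 0)
    (h : (a - b) * d * q = p * (a * (d + c))) :
    spp x * sp y = p / q := by
  have ha : a ≠ 0 := by
    rintro rfl
    exact hx₀ (by simp [hx])
  have hdc : d + c ≠ 0 := by
    intro h0
    apply hy₁
    rw [hy, eq_neg_of_add_eq_zero_right h0, neg_div, div_self hd, neg_neg]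
  have hspp : spp x = (a - b) / a := by
    rw [spp, hx, one_div_div, sub_div, div_self ha]
  have hsp : sp y = d / (d + c) := by
    have e : 1 - y = (d + c) / d := by
      rw [hy]
      field_simp
      ring
    rw [sp, e, one_div_div]
  rw [hspp, hsp, div_mul_div_comm, div_eq_div_iff (mul_ne_zero ha hdc) hq, h]

/-- The product of `1/(1-x)` and `1 - 1/y` for `x = a/b` and `y = -(c/d)`. -/
lemma sp_mul_spp_of_eq_div {a b c d x y : ℂ} (hb : b ≠ 0)
    (hx : x = a / b) (hy : y = -(c / d)) (hx₁ : x ≠ 1) (hy₀ : y ≠ 0) {p q : ℂ} (hq : q ≠ 0)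
    (h : b * (c + d) * q = p * ((b - a) * c)) :
    sp x * spp y = p / q := by
  have hba : b - a ≠ 0 := by
    intro h0
    exact hx₁ (by rw [hx, ← sub_eq_zero.mp h0, div_self hb])
  have hc : c ≠ 0 := by
    rintro rfl
    exact hy₀ (by simp [hy])
  have hsp : sp x = b / (b - a) := by
    have e : 1 - x = (b - a) / b := by
      rw [hx]
      field_simp
    rw [sp, e, one_div_div]
  have hspp : spp y = (c + d) / c := by
    rw [spp, hy, one_div, inv_neg, inv_div, sub_neg_eq_add, add_div, div_self hc]
  rw [hsp, hspp, div_mul_div_comm, div_eq_div_iff (mul_ne_zero hba hc) hq, h]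

/-- **The explicit solution of the gluing equations of a `D`-block satisfies the six
exponentiated holonomy equations** around the six ideal vertices, where `u_l = e^{H(m_l)/2}`. -/
theorem stmt_4 (u₁ u₂ u₃ u₄ u₅ u₆ z : ℂ)
    (h₁ : u₁ ≠ 0) (h₂ : u₂ ≠ 0) (h₃ : u₃ ≠ 0) (h₄ : u₄ ≠ 0) (h₅ : u₅ ≠ 0) (h₆ : u₆ ≠ 0)
    (hz : qA u₁ u₂ u₃ u₄ u₅ u₆ * z^2 + qB u₁ u₂ u₃ u₄ u₅ u₆ * z + qC u₁ u₂ u₃ u₄ u₅ u₆ = 0)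
    (hd₁ : z + u₂*u₃*u₄ ≠ 0)
    (hd₂ : z*u₁*u₃*u₅ + u₁*u₂*u₄*u₅ ≠ 0)
    (hd₃ : z*u₁*u₆ + u₂ ≠ 0)
    (hd₄ : z*u₁ + u₂*u₆ ≠ 0)
    (hd₅ : z*u₃*u₄ - u₂^2*u₃*u₄ ≠ 0)
    (hd₆ : z*u₁*u₅ - u₂*u₄ ≠ 0)
    (hd₇ : z*u₁ - u₂*u₄*u₅ ≠ 0)
    (hd₈ : z*u₂*u₆ - u₂*u₆ ≠ 0)
    (zs₁ zs₂ zs₃ zs₄ ws₁ ws₂ ws₃ ws₄ : ℂ)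
    (hzs₁ : zs₁ = (z - u₂^2)/(z + u₂*u₃*u₄))
    (hzs₂ : zs₂ = (z*u₁*u₃*u₅ - u₂*u₃*u₄)/(z*u₁*u₃*u₅ + u₁*u₂*u₄*u₅))
    (hzs₃ : zs₃ = (z*u₁*u₆ - u₂*u₄*u₅*u₆)/(z*u₁*u₆ + u₂))
    (hzs₄ : zs₄ = (z*u₁ - u₁)/(z*u₁ + u₂*u₆))
    (hws₁ : ws₁ = -((z*u₂ + u₂^2*u₃*u₄)/(z*u₃*u₄ - u₂^2*u₃*u₄)))
    (hws₂ : ws₂ = -((z*u₃ + u₂*u₄)/(z*u₁*u₅ - u₂*u₄)))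
    (hws₃ : ws₃ = -((z*u₁*u₄*u₅*u₆ + u₂*u₄*u₅)/(z*u₁ - u₂*u₄*u₅)))
    (hws₄ : ws₄ = -((z*u₁ + u₂*u₆)/(z*u₂*u₆ - u₂*u₆)))
    (hzs₁' : zs₁ ≠ 0 ∧ zs₁ ≠ 1) (hzs₂' : zs₂ ≠ 0 ∧ zs₂ ≠ 1)
    (hzs₃' : zs₃ ≠ 0 ∧ zs₃ ≠ 1) (hzs₄' : zs₄ ≠ 0 ∧ zs₄ ≠ 1)
    (hws₁' : ws₁ ≠ 0 ∧ ws₁ ≠ 1) (hws₂' : ws₂ ≠ 0 ∧ ws₂ ≠ 1)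
    (hws₃' : ws₃ ≠ 0 ∧ ws₃ ≠ 1) (hws₄' : ws₄ ≠ 0 ∧ ws₄ ≠ 1) :
    zs₄ * ws₄ = u₁^2 * spp zs₃ * sp zs₁ * spp ws₁ * sp ws₃
    ∧ sp zs₄ * spp ws₄ = u₂^2 * sp zs₁ * spp ws₁
    ∧ spp zs₁ * sp ws₁ = u₃^2 * spp zs₂ * sp ws₂
    ∧ zs₃ * ws₃ = u₄^2 * spp zs₄ * sp zs₂ * spp ws₂ * sp ws₄
    ∧ sp zs₂ * spp ws₂ = u₅^2 * sp zs₃ * spp ws₃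
    ∧ spp zs₄ * sp ws₄ = u₆^2 * spp zs₃ * sp ws₃ := by
  have hz₀ : z ≠ 0 := by
    rintro rfl
    apply hws₄'.2
    rw [hws₄]
    field_simp
    ring
  have P₁ : spp zs₁ * sp ws₁ = -(u₂*u₃*u₄) / z :=
    spp_mul_sp_of_eq_div hd₅ hzs₁ hws₁ hzs₁'.1 hws₁'.2
      (by simp [hz₀]) (by ring)
  have Q₁ : sp zs₁ * spp ws₁ = z / u₂^2 :=
    sp_mul_spp_of_eq_div hd₁ hzs₁ hws₁ hzs₁'.2 hws₁'.1
      (by simp [h₂]) (by ring)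
  have P₂ : spp zs₂ * sp ws₂ = -(u₂*u₄) / (u₃*z) :=
    spp_mul_sp_of_eq_div hd₆ hzs₂ hws₂ hzs₂'.1 hws₂'.2
      (by simp [h₃, hz₀]) (by ring)
  have Q₂ : sp zs₂ * spp ws₂ = z*u₁*u₅ / (u₂*u₄) :=
    sp_mul_spp_of_eq_div hd₂ hzs₂ hws₂ hzs₂'.2 hws₂'.1
      (by simp [h₂, h₄]) (by ring)
  have P₃ : spp zs₃ * sp ws₃ = -u₂ / (u₁*u₆*z) :=
    spp_mul_sp_of_eq_div hd₇ hzs₃ hws₃ hzs₃'.1 hws₃'.2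
      (by simp [h₁, h₆, hz₀]) (by ring)
  have Q₃ : sp zs₃ * spp ws₃ = z*u₁ / (u₂*u₄*u₅) :=
    sp_mul_spp_of_eq_div hd₃ hzs₃ hws₃ hzs₃'.2 hws₃'.1
      (by simp [h₂, h₄, h₅]) (by ring)
  have P₄ : spp zs₄ * sp ws₄ = -(u₂*u₆) / (u₁*z) :=
    spp_mul_sp_of_eq_div hd₈ hzs₄ hws₄ hzs₄'.1 hws₄'.2
      (by simp [h₁, hz₀]) (by ring)
  have Q₄ : sp zs₄ * spp ws₄ = z / 1 :=
    sp_mul_spp_of_eq_div hd₄ hzs₄ hws₄ hzs₄'.2 hws₄'.1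
      (by simp) (by ring)
  have R₃ : zs₃ * ws₃ = -(u₄*u₅*u₆) := by
    rw [hzs₃, hws₃, mul_neg, div_mul_div_comm, neg_inj, div_eq_iff (mul_ne_zero hd₃ hd₇)]
    ring
  have R₄ : zs₄ * ws₄ = -(u₁/(u₂*u₆)) := by
    rw [hzs₄, hws₄, mul_neg, div_mul_div_comm, neg_inj,
      div_eq_div_iff (mul_ne_zero hd₄ hd₈) (mul_ne_zero h₂ h₆)]
    ring
  refine ⟨?_, ?_, ?_, ?_, ?_, ?_⟩
  · calc zs₄ * ws₄ = u₁^2 * (-u₂ / (u₁*u₆*z)) * (z / u₂^2) := by rw [R₄]; field_simp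
      _ = _ := by rw [← P₃, ← Q₁]; ring
  · rw [Q₄, mul_assoc (u₂^2), Q₁]
    field_simp
  · rw [P₁, mul_assoc (u₃^2), P₂]
    field_simp
  · calc zs₃ * ws₃ = u₄^2 * (-(u₂*u₆) / (u₁*z)) * (z*u₁*u₅ / (u₂*u₄)) := by rw [R₃]; field_simp
      _ = _ := by rw [← P₄, ← Q₂]; ring
  · rw [Q₂, mul_assoc (u₅^2), Q₃]
    field_simp
  · rw [P₄, mul_assoc (u₆^2), P₃]
    field_simp
end

section
/- Let u₁,…,u₆ ∈ ℂ be nonzero and let A, B, C be as defined below. For l = 1,…,6 set c_l = (u_l + u_l⁻¹)/2. Then B² − 4AC = 16·det 𝔾(c₁,…,c₆), where 𝔾(c₁,…,c₆) is the 4×4 complex matrix with rows (1, −c₁, −c₆, −c₅), (−c₁, 1, −c₂, −c₃), (−c₆, −c₂, 1, −c₄), (−c₅, −c₃, −c₄, 1). -/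
open Matrix

/-- The Gram matrix `𝔾(c₁,…,c₆)` associated to a `D`-block. -/
noncomputable def GramM (c₁ c₂ c₃ c₄ c₅ c₆ : ℂ) : Matrix (Fin 4) (Fin 4) ℂ :=
  !![1, -c₁, -c₆, -c₅;
     -c₁, 1, -c₂, -c₃;
     -c₆, -c₂, 1, -c₄;
     -c₅, -c₃, -c₄, 1]

/-- The determinant of the Gram matrix, written out as a polynomial in its entries. -/
theorem det_GramM (c₁ c₂ c₃ c₄ c₅ c₆ : ℂ) :
    (GramM c₁ c₂ c₃ c₄ c₅ c₆).det =
      1 - c₁ ^ 2 - c₂ ^ 2 - c₃ ^ 2 - c₄ ^ 2 - c₅ ^ 2 - c₆ ^ 2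
        + c₁ ^ 2 * c₄ ^ 2 + c₂ ^ 2 * c₅ ^ 2 + c₃ ^ 2 * c₆ ^ 2
        - 2 * (c₁ * c₂ * c₆ + c₁ * c₃ * c₅ + c₂ * c₃ * c₄ + c₄ * c₅ * c₆)
        - 2 * (c₁ * c₂ * c₄ * c₅ + c₁ * c₃ * c₄ * c₆ + c₂ * c₃ * c₅ * c₆) := by
  simp [GramM, Matrix.det_succ_row_zero, Fin.sum_univ_succ, Fin.succAbove]
  ring

/-- **The discriminant of the quadratic equation of a `D`-block equals `16` times the
determinant of the associated Gram matrix**, where `c_l = (u_l + u_l⁻¹)/2 = cosh(H(m_l)/2)`. -/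
theorem stmt_5 (u₁ u₂ u₃ u₄ u₅ u₆ : ℂ)
    (h₁ : u₁ ≠ 0) (h₂ : u₂ ≠ 0) (h₃ : u₃ ≠ 0) (h₄ : u₄ ≠ 0) (h₅ : u₅ ≠ 0) (h₆ : u₆ ≠ 0) :
    qB u₁ u₂ u₃ u₄ u₅ u₆ ^ 2 - 4 * qA u₁ u₂ u₃ u₄ u₅ u₆ * qC u₁ u₂ u₃ u₄ u₅ u₆
      = 16 * (GramM ((u₁ + u₁⁻¹)/2) ((u₂ + u₂⁻¹)/2) ((u₃ + u₃⁻¹)/2)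
          ((u₄ + u₄⁻¹)/2) ((u₅ + u₅⁻¹)/2) ((u₆ + u₆⁻¹)/2)).det := by
  rw [det_GramM, qA, qB, qC]
  field_simp
  ring
end

section
/- Define the polynomial f_D(t₁,t₂,t₃,t₁₂,t₁₃,t₂₃) = (t₁₂t₃ + t₁₃t₂ + t₂₃t₁ − t₁t₂t₃)² − 4(t₁² + t₂² + t₃² + t₁₂² + t₁₃² + t₂₃² − t₁t₂t₁₂ − t₁t₃t₁₃ − t₂t₃t₂₃ + t₁₂t₁₃t₂₃ − 4). Then for all complex numbers c₁,…,c₆, setting t_l = −2c_l for l = 1,…,6, one has f_D(t₁, t₂, t₃, t₁t₂ − t₆, t₁t₃ − t₅, t₂t₃ − t₄) = 16·det 𝔾(c₁,…,c₆), where 𝔾(c₁,…,c₆) is the 4×4 complex matrix with rows (1, −c₁, −c₆, −c₅), (−c₁, 1, −c₂, −c₃), (−c₆, −c₂, 1, −c₄), (−c₅, −c₃, −c₄, 1). -/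
open Matrix

/-- Goldman's branching polynomial for the `SL(2;ℂ)`-character variety of the rank-3
free group. -/
noncomputable def fD (t₁ t₂ t₃ t₁₂ t₁₃ t₂₃ : ℂ) : ℂ :=
  (t₁₂*t₃ + t₁₃*t₂ + t₂₃*t₁ - t₁*t₂*t₃)^2
    - 4*(t₁^2 + t₂^2 + t₃^2 + t₁₂^2 + t₁₃^2 + t₂₃^2
          - t₁*t₂*t₁₂ - t₁*t₃*t₁₃ - t₂*t₃*t₂₃ + t₁₂*t₁₃*t₂₃ - 4)

/-- **Goldman's branching polynomial equals `16` times the determinant of the associated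
Gram matrix**, under the trace identities `t_l = −2c_l`,
`Tr ρ([m₂m₃]) = t₂t₃ − t₄`, `Tr ρ([m₁m₃]) = t₁t₃ − t₅`, `Tr ρ([m₁m₂]) = t₁t₂ − t₆`. -/
theorem stmt_6 (c₁ c₂ c₃ c₄ c₅ c₆ : ℂ) :
    fD (-2*c₁) (-2*c₂) (-2*c₃)
       ((-2*c₁)*(-2*c₂) - (-2*c₆)) ((-2*c₁)*(-2*c₃) - (-2*c₅)) ((-2*c₂)*(-2*c₃) - (-2*c₄))
      = 16 * (GramM c₁ c₂ c₃ c₄ c₅ c₆).det := by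
  simp [fD, GramM, Matrix.det_succ_row_zero, Fin.sum_univ_succ, Fin.succAbove]
  ring
end

section
/- Let φ, φ' ∈ ℂ with sin φ' ≠ 0 and sin(φ+φ') ≠ 0. Let p be the derivative at φ of the function x ↦ (sin φ'/sin(x+φ'))·e^{√−1·x}, let q be the derivative at φ' of the function y ↦ (sin y/sin(φ+y))·e^{√−1·φ}, let r be the derivative at φ of the function x ↦ (sin(x+φ')/sin φ')·e^{√−1·x}, and let s be the derivative at φ' of the function y ↦ (sin(φ+y)/sin y)·e^{√−1·φ}. Then p·s − q·r = −2√−1·e^{2√−1·φ}·sin φ/(sin φ'·sin(φ+φ')). -/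
open Complex

/-- **Jacobian of the change of variables `ψ : (φ, φ') ↦ (z, z̃)`** parametrizing the pair of
shape parameters `z = (sin φ'/sin(φ+φ'))·e^{iφ}` and `z̃ = (sin(φ+φ')/sin φ')·e^{iφ}`:
its determinant is `−2i·e^{2iφ}·sin φ/(sin φ'·sin(φ+φ'))`. -/
theorem stmt_8 (φ φ' : ℂ) (hφ' : Complex.sin φ' ≠ 0) (hφφ' : Complex.sin (φ + φ') ≠ 0)
    (p q r s : ℂ)
    (hp : p = deriv (fun x : ℂ => (Complex.sin φ' / Complex.sin (x + φ')) * Complex.exp (I * x)) φ)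
    (hq : q = deriv (fun y : ℂ => (Complex.sin y / Complex.sin (φ + y)) * Complex.exp (I * φ)) φ')
    (hr : r = deriv (fun x : ℂ => (Complex.sin (x + φ') / Complex.sin φ') * Complex.exp (I * x)) φ)
    (hs : s = deriv (fun y : ℂ => (Complex.sin (φ + y) / Complex.sin y) * Complex.exp (I * φ)) φ') :
    p * s - q * r
      = -2 * I * Complex.exp (2 * I * φ) * Complex.sin φ
          / (Complex.sin φ' * Complex.sin (φ + φ')) := by
  have hS : HasDerivAt Complex.sin (Complex.cos φ') φ' := Complex.hasDerivAt_sin φ'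
  have hT₁ : HasDerivAt (fun x : ℂ => Complex.sin (x + φ')) (Complex.cos (φ + φ')) φ :=
    (Complex.hasDerivAt_sin (φ + φ')).comp_add_const φ φ'
  have hT₂ : HasDerivAt (fun y : ℂ => Complex.sin (φ + y)) (Complex.cos (φ + φ')) φ' :=
    (Complex.hasDerivAt_sin (φ + φ')).comp_const_add φ φ'
  have hE : HasDerivAt (fun x : ℂ => Complex.exp (I * x)) (Complex.exp (I * φ) * I) φ := by
    simpa using ((hasDerivAt_id φ).const_mul I).cexp
  have hp' := ((hasDerivAt_const φ (Complex.sin φ')).fun_div hT₁ hφφ').fun_mul hE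
  have hq' := (hS.fun_div hT₂ hφφ').mul_const (Complex.exp (I * φ))
  have hr' := (hT₁.div_const (Complex.sin φ')).fun_mul hE
  have hs' := (hT₂.fun_div hS hφ').mul_const (Complex.exp (I * φ))
  have hexp : Complex.exp (2 * I * φ) = Complex.exp (I * φ) ^ 2 := by
    rw [← Complex.exp_nat_mul]
    push_cast
    ring_nf
  have hsin : Complex.sin φ = Complex.sin (φ + φ') * Complex.cos φ'
      - Complex.cos (φ + φ') * Complex.sin φ' := by
    rw [← Complex.sin_sub, add_sub_cancel_right]
  rw [hp, hq, hr, hs, hp'.deriv, hq'.deriv, hr'.deriv, hs'.deriv, hexp, hsin]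
  field_simp
  ring
end

section
/- Let φ₁,…,φ₄, φ₁',…,φ₄' ∈ ℂ satisfy φ₁+φ₂+φ₃+φ₄ = 2π, and assume sin φ_k ≠ 0, sin φ_k' ≠ 0 and sin(φ_k+φ_k') ≠ 0 for k = 1,…,4. For k = 1,…,4 set z_k = (sin φ_k'/sin(φ_k+φ_k'))·e^{√−1·φ_k} and z̃_k = (sin(φ_k+φ_k')/sin φ_k')·e^{√−1·φ_k}, and assume each z_k and each z̃_k is different from 0 and 1. Then det D(z₁,z₂,z₃,z₄,z̃₁,z̃₂,z̃₃,z̃₄) = −2⁶·√−1·( ∑_{k=1}^{4} sin φ_k/(sin φ_k'·sin(φ_k+φ_k')) )·∏_{k=1}^{4} ( sin φ_k'·sin(φ_k+φ_k')/sin φ_k ). -/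
open Complex Matrix

/-- The Jacobian of the gluing map of the ideal triangulation of a `D`-block. -/
noncomputable def DJac (z₁ z₂ z₃ z₄ w₁ w₂ w₃ w₄ : ℂ) : Matrix (Fin 8) (Fin 8) ℂ :=
  !![1/z₁, 1/z₂, 1/z₃, 1/z₄, 0, 0, 0, 0;
     0, 0, 0, 0, 1/w₁, 1/w₂, 1/w₃, 1/w₄;
     -1/(1-z₁), 0, -1/(z₃*(z₃-1)), 1/z₄, -1/(w₁*(w₁-1)), 0, -1/(1-w₃), 1/w₄;
     -1/(1-z₁), 0, 0, 1/(1-z₄), -1/(w₁*(w₁-1)), 0, 0, 1/(w₄*(w₄-1));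
     1/(z₁*(z₁-1)), -1/(z₂*(z₂-1)), 0, 0, 1/(1-w₁), -1/(1-w₂), 0, 0;
     0, -1/(1-z₂), 1/z₃, -1/(z₄*(z₄-1)), 0, -1/(w₂*(w₂-1)), 1/w₃, -1/(1-w₄);
     0, 1/(1-z₂), -1/(1-z₃), 0, 0, 1/(w₂*(w₂-1)), -1/(w₃*(w₃-1)), 0;
     0, 0, -1/(z₃*(z₃-1)), 1/(z₄*(z₄-1)), 0, 0, -1/(1-w₃), 1/(1-w₄)]

set_option maxHeartbeats 1000000 in
/-- Row operations and one row swap turn `DJac` into a matrix whose upper half consists of two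
diagonal blocks. -/
lemma DJac_submatrix_swap {z₁ z₂ z₃ z₄ w₁ w₂ w₃ w₄ : ℂ}
    (hz₁ : z₁ ≠ 0 ∧ z₁ ≠ 1) (hz₂ : z₂ ≠ 0 ∧ z₂ ≠ 1)
    (hz₃ : z₃ ≠ 0 ∧ z₃ ≠ 1) (hz₄ : z₄ ≠ 0 ∧ z₄ ≠ 1)
    (hw₁ : w₁ ≠ 0 ∧ w₁ ≠ 1) (hw₂ : w₂ ≠ 0 ∧ w₂ ≠ 1)
    (hw₃ : w₃ ≠ 0 ∧ w₃ ≠ 1) (hw₄ : w₄ ≠ 0 ∧ w₄ ≠ 1) :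
    ((DJac z₁ z₂ z₃ z₄ w₁ w₂ w₃ w₄).submatrix (Equiv.swap 0 5) id).submatrix
        (finSumFinEquiv (m := 4) (n := 4)) (finSumFinEquiv (m := 4) (n := 4)) =
      fromBlocks
          !![0, 0, 2, 0; 1, 1, 1, 1; 1, -1, 1, 1; 1, -1, 1, -1]
          !![0, 0, -1, -1; 0, -1, 0, 0; 1, 0, -1, 0; 1, 0, -1, -1]
          0 1 *
        fromBlocks
          (diagonal ![1/z₁, 1/z₂, 1/z₃, 1/z₄]) (diagonal ![1/w₁, 1/w₂, 1/w₃, 1/w₄])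
          !![1/(z₁*(z₁-1)), -1/(z₂*(z₂-1)), 0, 0;
             1/z₁, 1/z₂, 1/z₃, 1/z₄;
             0, 1/(1-z₂), -1/(1-z₃), 0;
             0, 0, -1/(z₃*(z₃-1)), 1/(z₄*(z₄-1))]
          !![1/(1-w₁), -1/(1-w₂), 0, 0;
             0, 0, 0, 0;
             0, 1/(w₂*(w₂-1)), -1/(w₃*(w₃-1)), 0;
             0, 0, -1/(1-w₃), 1/(1-w₄)] := by
  have sub {x : ℂ} (h : x ≠ 0 ∧ x ≠ 1) : 1 / (x * (x - 1)) = -(1 / x) - 1 / (1 - x) := by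
    have h₁ : x - 1 ≠ 0 := sub_ne_zero.2 h.2
    have h₂ : 1 - x ≠ 0 := sub_ne_zero.2 h.2.symm
    field_simp [h.1]
    ring
  rw [DJac, fromBlocks_multiply]
  simp only [neg_div, sub hz₁, sub hz₂, sub hz₃, sub hz₄, sub hw₁, sub hw₂, sub hw₃, sub hw₄]
  have s (j : Fin 8) : Equiv.swap (0 : Fin 8) 5 j = ![5, 1, 2, 3, 4, 0, 6, 7] j := by
    revert j; decide
  ext (i | i) (j | j) <;>
    simp only [fromBlocks_apply₁₁, fromBlocks_apply₁₂, fromBlocks_apply₂₁, fromBlocks_apply₂₂,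
      Matrix.add_apply, mul_diagonal, zero_mul, one_mul, zero_add, submatrix_apply, s, id] <;>
    fin_cases i <;> fin_cases j <;>
    simp [finSumFinEquiv, Fin.natAdd, Fin.castAdd, Fin.castLE] <;> ring

/-- The determinant of `DJac` in terms of the shape parameters. -/
lemma det_DJac {z₁ z₂ z₃ z₄ w₁ w₂ w₃ w₄ : ℂ}
    (hz₁ : z₁ ≠ 0 ∧ z₁ ≠ 1) (hz₂ : z₂ ≠ 0 ∧ z₂ ≠ 1)
    (hz₃ : z₃ ≠ 0 ∧ z₃ ≠ 1) (hz₄ : z₄ ≠ 0 ∧ z₄ ≠ 1)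
    (hw₁ : w₁ ≠ 0 ∧ w₁ ≠ 1) (hw₂ : w₂ ≠ 0 ∧ w₂ ≠ 1)
    (hw₃ : w₃ ≠ 0 ∧ w₃ ≠ 1) (hw₄ : w₄ ≠ 0 ∧ w₄ ≠ 1)
    {h₁ h₂ h₃ h₄ : ℂ}
    (hh₁ : h₁ = (1 - z₁ * w₁) / ((1 - z₁) * (1 - w₁)))
    (hh₂ : h₂ = (1 - z₂ * w₂) / ((1 - z₂) * (1 - w₂)))
    (hh₃ : h₃ = (1 - z₃ * w₃) / ((1 - z₃) * (1 - w₃)))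
    (hh₄ : h₄ = (1 - z₄ * w₄) / ((1 - z₄) * (1 - w₄))) :
    (DJac z₁ z₂ z₃ z₄ w₁ w₂ w₃ w₄).det =
      8 * (h₂ * h₃ * h₄ + h₁ * h₃ * h₄ + h₁ * h₂ * h₄ + h₁ * h₂ * h₃) /
        ((z₁ * w₁) * (z₂ * w₂) * (z₃ * w₃) * (z₄ * w₄)) := by
  have hdet : (DJac z₁ z₂ z₃ z₄ w₁ w₂ w₃ w₄).det =
      -((DJac z₁ z₂ z₃ z₄ w₁ w₂ w₃ w₄).submatrix (Equiv.swap 0 5) id).det := by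
    rw [det_permute, Equiv.Perm.sign_swap (by decide)]
    simp
  have hT : (!![0, 0, 2, 0; 1, 1, 1, 1; 1, -1, 1, 1; 1, -1, 1, -1] :
      Matrix (Fin 4) (Fin 4) ℂ).det = 8 := by
    simp [det_succ_row_zero, Fin.sum_univ_succ, Fin.succAbove]
    norm_num
  let a : Fin 4 → ℂ := ![1/z₁, 1/z₂, 1/z₃, 1/z₄]
  let a' : Fin 4 → ℂ := ![z₁, z₂, z₃, z₄]
  have haa' (i : Fin 4) : a' i * a i = 1 := by
    fin_cases i <;> simp [a, a', hz₁.1, hz₂.1, hz₃.1, hz₄.1]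
  let _ : Invertible (diagonal a) :=
    ⟨diagonal a', by simp [haa'], by simp [mul_comm (a _), haa']⟩
  have hinv : ⅟(diagonal a) = diagonal a' := rfl
  have schur {z w h : ℂ} (hz : z ≠ 0 ∧ z ≠ 1) (hw : w ≠ 0 ∧ w ≠ 1)
      (hh : h = (1 - z * w) / ((1 - z) * (1 - w))) :
      1 / (1 - w) - 1 / (z * (z - 1)) * z * (1 / w) = h / w ∧
        1 / (w * (w - 1)) - 1 / (1 - z) * z * (1 / w) = -(h / w) := by
    have e₁ : 1 - z ≠ 0 := sub_ne_zero.2 hz.2.symm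
    have e₂ : 1 - w ≠ 0 := sub_ne_zero.2 hw.2.symm
    have e₃ : z - 1 = -(1 - z) := by ring
    have e₄ : w - 1 = -(1 - w) := by ring
    rw [hh, e₃, e₄]
    constructor <;> field_simp [hz.1, hw.1] <;> ring
  have hS : !![1/(1-w₁), -1/(1-w₂), 0, 0;
             0, 0, 0, 0;
             0, 1/(w₂*(w₂-1)), -1/(w₃*(w₃-1)), 0;
             0, 0, -1/(1-w₃), 1/(1-w₄)] -
        !![1/(z₁*(z₁-1)), -1/(z₂*(z₂-1)), 0, 0;
             1/z₁, 1/z₂, 1/z₃, 1/z₄;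
             0, 1/(1-z₂), -1/(1-z₃), 0;
             0, 0, -1/(z₃*(z₃-1)), 1/(z₄*(z₄-1))] * diagonal a' *
          diagonal ![1/w₁, 1/w₂, 1/w₃, 1/w₄] =
      !![h₁/w₁, -(h₂/w₂), 0, 0; -(1/w₁), -(1/w₂), -(1/w₃), -(1/w₄);
        0, -(h₂/w₂), h₃/w₃, 0; 0, 0, -(h₃/w₃), h₄/w₄] := by
    obtain ⟨p₁, -⟩ := schur hz₁ hw₁ hh₁
    obtain ⟨p₂, q₂⟩ := schur hz₂ hw₂ hh₂
    obtain ⟨p₃, q₃⟩ := schur hz₃ hw₃ hh₃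
    obtain ⟨p₄, -⟩ := schur hz₄ hw₄ hh₄
    ext i j
    rw [Matrix.sub_apply, mul_diagonal, mul_diagonal]
    fin_cases i <;> fin_cases j <;>
      simp only [a', Fin.zero_eta, Fin.mk_one, Fin.reduceFinMk, of_apply, cons_val] <;>
      first
      | simp [hz₁.1, hz₂.1, hz₃.1, hz₄.1]; done
      | linear_combination p₁
      | linear_combination -p₂
      | linear_combination q₂
      | linear_combination -p₃
      | linear_combination -q₃
      | linear_combination p₄
  rw [hdet, ← det_submatrix_equiv_self (finSumFinEquiv (m := 4) (n := 4)),
    DJac_submatrix_swap hz₁ hz₂ hz₃ hz₄ hw₁ hw₂ hw₃ hw₄, det_mul, det_fromBlocks_zero₂₁, hT,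
    det_one]
  change -(8 * 1 * (fromBlocks (diagonal a) _ _ _).det) = _
  rw [det_fromBlocks₁₁, hinv, hS, det_diagonal, Fin.prod_univ_four]
  have hz₁ := hz₁.1
  have hz₂ := hz₂.1
  have hz₃ := hz₃.1
  have hz₄ := hz₄.1
  have hw₁ := hw₁.1
  have hw₂ := hw₂.1
  have hw₃ := hw₃.1
  have hw₄ := hw₄.1
  simp [det_succ_row_zero, Fin.sum_univ_succ, Fin.succAbove, a]
  clear * - hz₁ hz₂ hz₃ hz₄ hw₁ hw₂ hw₃ hw₄
  field_simp
  ring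

/-- The shape parameters in angle coordinates. -/
lemma shape_of_angles {φ ψ z w : ℂ} (hs : Complex.sin φ ≠ 0) (ht : Complex.sin ψ ≠ 0)
    (hst : Complex.sin (φ + ψ) ≠ 0)
    (hz : z = (Complex.sin ψ / Complex.sin (φ + ψ)) * Complex.exp (I * φ))
    (hw : w = (Complex.sin (φ + ψ) / Complex.sin ψ) * Complex.exp (I * φ))
    (hz' : z ≠ 1) (hw' : w ≠ 1) :
    z * w = Complex.exp (I * φ) ^ 2 ∧
      2 * I * (Complex.sin ψ * Complex.sin (φ + ψ) / Complex.sin φ) =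
        (1 - z * w) / ((1 - z) * (1 - w)) := by
  have hzw : z * w = Complex.exp (I * φ) ^ 2 := by
    rw [hz, hw]
    field_simp
  refine ⟨hzw, ?_⟩
  have e₁ : 1 - z ≠ 0 := sub_ne_zero.2 hz'.symm
  have e₂ : 1 - w ≠ 0 := sub_ne_zero.2 hw'.symm
  have hE : Complex.exp (I * φ) = Complex.cos φ + Complex.sin φ * I := by
    rw [mul_comm, exp_mul_I]
  have hprod : Complex.sin ψ * Complex.sin (φ + ψ) * ((1 - z) * (1 - w)) =
      -(Complex.sin φ ^ 2 * Complex.exp (I * φ)) := by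
    have : Complex.sin ψ * Complex.sin (φ + ψ) * ((1 - z) * (1 - w)) =
        (Complex.sin (φ + ψ) - Complex.sin ψ * Complex.exp (I * φ)) *
          (Complex.sin ψ - Complex.sin (φ + ψ) * Complex.exp (I * φ)) := by
      rw [hz, hw]
      field_simp
    rw [this, hE, Complex.sin_add]
    have h₁ := Complex.sin_sq_add_cos_sq φ
    have h₂ := Complex.sin_sq_add_cos_sq ψ
    have h₃ := I_sq
    linear_combination
      -(Complex.sin φ * (Complex.cos ψ - Complex.sin ψ * I) * Complex.sin ψ) * h₁ -
      Complex.sin φ ^ 2 * (Complex.cos φ + Complex.sin φ * I) * h₂ +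
      (Complex.sin φ ^ 3 * Complex.sin ψ * (Complex.cos ψ - Complex.sin ψ * I) +
        Complex.sin φ ^ 2 * Complex.sin ψ ^ 2 * (Complex.cos φ + Complex.sin φ * I)) * h₃
  have hsq : 1 - Complex.exp (I * φ) ^ 2 = -(2 * I * Complex.sin φ * Complex.exp (I * φ)) := by
    rw [hE]
    linear_combination -Complex.sin_sq_add_cos_sq φ + Complex.sin φ ^ 2 * I_sq
  rw [eq_div_iff (mul_ne_zero e₁ e₂), hzw, hsq]
  field_simp
  linear_combination hprod

/-- **Determinant of the Jacobian of the `D`-block gluing map in angle coordinates**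
(Lemma 4.5 of the paper). -/
theorem stmt_10 (φ₁ φ₂ φ₃ φ₄ ψ₁ ψ₂ ψ₃ ψ₄ : ℂ)
    (hsum : φ₁ + φ₂ + φ₃ + φ₄ = 2 * (Real.pi : ℂ))
    (hs₁ : Complex.sin φ₁ ≠ 0) (hs₂ : Complex.sin φ₂ ≠ 0)
    (hs₃ : Complex.sin φ₃ ≠ 0) (hs₄ : Complex.sin φ₄ ≠ 0)
    (ht₁ : Complex.sin ψ₁ ≠ 0) (ht₂ : Complex.sin ψ₂ ≠ 0)
    (ht₃ : Complex.sin ψ₃ ≠ 0) (ht₄ : Complex.sin ψ₄ ≠ 0)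
    (hst₁ : Complex.sin (φ₁ + ψ₁) ≠ 0) (hst₂ : Complex.sin (φ₂ + ψ₂) ≠ 0)
    (hst₃ : Complex.sin (φ₃ + ψ₃) ≠ 0) (hst₄ : Complex.sin (φ₄ + ψ₄) ≠ 0)
    (z₁ z₂ z₃ z₄ w₁ w₂ w₃ w₄ : ℂ)
    (hz₁ : z₁ = (Complex.sin ψ₁ / Complex.sin (φ₁ + ψ₁)) * Complex.exp (I * φ₁))
    (hz₂ : z₂ = (Complex.sin ψ₂ / Complex.sin (φ₂ + ψ₂)) * Complex.exp (I * φ₂))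
    (hz₃ : z₃ = (Complex.sin ψ₃ / Complex.sin (φ₃ + ψ₃)) * Complex.exp (I * φ₃))
    (hz₄ : z₄ = (Complex.sin ψ₄ / Complex.sin (φ₄ + ψ₄)) * Complex.exp (I * φ₄))
    (hw₁ : w₁ = (Complex.sin (φ₁ + ψ₁) / Complex.sin ψ₁) * Complex.exp (I * φ₁))
    (hw₂ : w₂ = (Complex.sin (φ₂ + ψ₂) / Complex.sin ψ₂) * Complex.exp (I * φ₂))
    (hw₃ : w₃ = (Complex.sin (φ₃ + ψ₃) / Complex.sin ψ₃) * Complex.exp (I * φ₃))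
    (hw₄ : w₄ = (Complex.sin (φ₄ + ψ₄) / Complex.sin ψ₄) * Complex.exp (I * φ₄))
    (hz₁' : z₁ ≠ 0 ∧ z₁ ≠ 1) (hz₂' : z₂ ≠ 0 ∧ z₂ ≠ 1)
    (hz₃' : z₃ ≠ 0 ∧ z₃ ≠ 1) (hz₄' : z₄ ≠ 0 ∧ z₄ ≠ 1)
    (hw₁' : w₁ ≠ 0 ∧ w₁ ≠ 1) (hw₂' : w₂ ≠ 0 ∧ w₂ ≠ 1)
    (hw₃' : w₃ ≠ 0 ∧ w₃ ≠ 1) (hw₄' : w₄ ≠ 0 ∧ w₄ ≠ 1) :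
    (DJac z₁ z₂ z₃ z₄ w₁ w₂ w₃ w₄).det
      = -2^6 * I
          * (Complex.sin φ₁ / (Complex.sin ψ₁ * Complex.sin (φ₁ + ψ₁))
              + Complex.sin φ₂ / (Complex.sin ψ₂ * Complex.sin (φ₂ + ψ₂))
              + Complex.sin φ₃ / (Complex.sin ψ₃ * Complex.sin (φ₃ + ψ₃))
              + Complex.sin φ₄ / (Complex.sin ψ₄ * Complex.sin (φ₄ + ψ₄)))
          * ((Complex.sin ψ₁ * Complex.sin (φ₁ + ψ₁) / Complex.sin φ₁)
              * (Complex.sin ψ₂ * Complex.sin (φ₂ + ψ₂) / Complex.sin φ₂)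
              * (Complex.sin ψ₃ * Complex.sin (φ₃ + ψ₃) / Complex.sin φ₃)
              * (Complex.sin ψ₄ * Complex.sin (φ₄ + ψ₄) / Complex.sin φ₄)) := by
  obtain ⟨p₁, q₁⟩ := shape_of_angles hs₁ ht₁ hst₁ hz₁ hw₁ hz₁'.2 hw₁'.2
  obtain ⟨p₂, q₂⟩ := shape_of_angles hs₂ ht₂ hst₂ hz₂ hw₂ hz₂'.2 hw₂'.2
  obtain ⟨p₃, q₃⟩ := shape_of_angles hs₃ ht₃ hst₃ hz₃ hw₃ hz₃'.2 hw₃'.2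
  obtain ⟨p₄, q₄⟩ := shape_of_angles hs₄ ht₄ hst₄ hz₄ hw₄ hz₄'.2 hw₄'.2
  have hprod : (z₁ * w₁) * (z₂ * w₂) * (z₃ * w₃) * (z₄ * w₄) = 1 := by
    rw [p₁, p₂, p₃, p₄, ← mul_pow, ← mul_pow, ← mul_pow, ← Complex.exp_add, ← Complex.exp_add,
      ← Complex.exp_add, ← mul_add, ← mul_add, ← mul_add, hsum, mul_comm, Complex.exp_two_pi_mul_I,
      one_pow]
  rw [det_DJac hz₁' hz₂' hz₃' hz₄' hw₁' hw₂' hw₃' hw₄' q₁ q₂ q₃ q₄, hprod]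
  clear * - hs₁ hs₂ hs₃ hs₄ ht₁ ht₂ ht₃ ht₄ hst₁ hst₂ hst₃ hst₄
  field_simp
  rw [I_sq]
  ring
end

section
/- Let θ₁,…,θ₆ ∈ ℂ and x ∈ ℂ. Define φ₁ = π/2 + (θ₂−θ₃−θ₄)/2, φ₂ = π/2 + (−θ₁+θ₃−θ₅)/2, φ₃ = π/2 + (θ₄+θ₅+θ₆)/2, φ₄ = π/2 + (θ₁−θ₂−θ₆)/2, and φ₁' = x − θ₂, φ₂' = x + (θ₁−θ₂−θ₄+θ₅)/2, φ₃' = x + (θ₁−θ₂−θ₄−θ₅)/2, φ₄' = x. Set u_l = e^{√−1·θ_l} for l = 1,…,6, set z = e^{2√−1·x}, and let A, B, C be as defined below. Then ∏_{k=1}^{4} sin φ_k' − ∏_{k=1}^{4} sin(φ_k+φ_k') = (1/16)·(A·z + B + C/z). -/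
open Complex

/-- The cosine of `t` as a rational function of any expression for `exp (I * t)`. -/
lemma cos_eq_of_exp_eq {t m : ℂ} (h : exp (I * t) = m) : cos t = (m + m⁻¹) / 2 := by
  rw [cos, ← h, ← exp_neg]
  ring_nf

/-- The sine of `t` as a rational function of any expression for `exp (I * t)`. -/
lemma sin_eq_of_exp_eq {t m : ℂ} (h : exp (I * t) = m) : sin t = (m⁻¹ - m) * I / 2 := by
  rw [sin, ← h, ← exp_neg]
  ring_nf

/-- **Reduction of the nonlinear gluing equation `r₁r₂r₃r₄ = 1` of a `D`-block to the
quadratic equation `Az² + Bz + C = 0`**: under the linear solution of the angle equations,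
`∏ sin φ_k' − ∏ sin(φ_k+φ_k') = (1/16)(Az + B + C/z)` with `u_l = e^{iθ_l}`, `z = e^{2ix}`. -/
theorem stmt_11 (θ₁ θ₂ θ₃ θ₄ θ₅ θ₆ x : ℂ)
    (φ₁ φ₂ φ₃ φ₄ ψ₁ ψ₂ ψ₃ ψ₄ : ℂ)
    (hφ₁ : φ₁ = (Real.pi : ℂ)/2 + (θ₂ - θ₃ - θ₄)/2)
    (hφ₂ : φ₂ = (Real.pi : ℂ)/2 + (-θ₁ + θ₃ - θ₅)/2)
    (hφ₃ : φ₃ = (Real.pi : ℂ)/2 + (θ₄ + θ₅ + θ₆)/2)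
    (hφ₄ : φ₄ = (Real.pi : ℂ)/2 + (θ₁ - θ₂ - θ₆)/2)
    (hψ₁ : ψ₁ = x - θ₂)
    (hψ₂ : ψ₂ = x + (θ₁ - θ₂ - θ₄ + θ₅)/2)
    (hψ₃ : ψ₃ = x + (θ₁ - θ₂ - θ₄ - θ₅)/2)
    (hψ₄ : ψ₄ = x)
    (u₁ u₂ u₃ u₄ u₅ u₆ z : ℂ)
    (hu₁ : u₁ = Complex.exp (I * θ₁)) (hu₂ : u₂ = Complex.exp (I * θ₂))
    (hu₃ : u₃ = Complex.exp (I * θ₃)) (hu₄ : u₄ = Complex.exp (I * θ₄))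
    (hu₅ : u₅ = Complex.exp (I * θ₅)) (hu₆ : u₆ = Complex.exp (I * θ₆))
    (hz : z = Complex.exp (2 * I * x)) :
    Complex.sin ψ₁ * Complex.sin ψ₂ * Complex.sin ψ₃ * Complex.sin ψ₄
      - Complex.sin (φ₁ + ψ₁) * Complex.sin (φ₂ + ψ₂)
          * Complex.sin (φ₃ + ψ₃) * Complex.sin (φ₄ + ψ₄)
      = (1/16) * (qA u₁ u₂ u₃ u₄ u₅ u₆ * z + qB u₁ u₂ u₃ u₄ u₅ u₆
          + qC u₁ u₂ u₃ u₄ u₅ u₆ / z) := by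
  have half_sq (t : ℂ) : exp (I * t) = exp (I * t / 2) ^ 2 := by
    rw [← exp_nat_mul]; ring_nf
  have half_sq_x : exp (2 * I * x) = exp (I * x) ^ 2 := by
    rw [← exp_nat_mul]; ring_nf
  have e₁ : φ₁ + ψ₁ = (x + (-θ₂ - θ₃ - θ₄) / 2) + (Real.pi : ℂ) / 2 := by
    rw [hφ₁, hψ₁]; ring
  have e₂ : φ₂ + ψ₂ = (x + (θ₃ - θ₂ - θ₄) / 2) + (Real.pi : ℂ) / 2 := by
    rw [hφ₂, hψ₂]; ring
  have e₃ : φ₃ + ψ₃ = (x + (θ₁ - θ₂ + θ₆) / 2) + (Real.pi : ℂ) / 2 := by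
    rw [hφ₃, hψ₃]; ring
  have e₄ : φ₄ + ψ₄ = (x + (θ₁ - θ₂ - θ₆) / 2) + (Real.pi : ℂ) / 2 := by
    rw [hφ₄, hψ₄]; ring
  rw [e₁, e₂, e₃, e₄, hψ₁, hψ₂, hψ₃, hψ₄]
  simp only [sin_add_pi_div_two]
  have s₁ : exp (I * (x - θ₂)) = exp (I * x) / exp (I * θ₂ / 2) ^ 2 := by
    rw [← half_sq, ← exp_sub]; ring_nf
  have s₂ : exp (I * (x + (θ₁ - θ₂ - θ₄ + θ₅) / 2)) =
      exp (I * x) * exp (I * θ₁ / 2) * exp (I * θ₅ / 2) / (exp (I * θ₂ / 2) * exp (I * θ₄ / 2)) := by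
    simp only [← exp_add, ← exp_sub]; ring_nf
  have s₃ : exp (I * (x + (θ₁ - θ₂ - θ₄ - θ₅) / 2)) =
      exp (I * x) * exp (I * θ₁ / 2) / (exp (I * θ₂ / 2) * exp (I * θ₄ / 2) * exp (I * θ₅ / 2)) := by
    simp only [← exp_add, ← exp_sub]; ring_nf
  have c₁ : exp (I * (x + (-θ₂ - θ₃ - θ₄) / 2)) =
      exp (I * x) / (exp (I * θ₂ / 2) * exp (I * θ₃ / 2) * exp (I * θ₄ / 2)) := by
    simp only [← exp_add, ← exp_sub]; ring_nf
  have c₂ : exp (I * (x + (θ₃ - θ₂ - θ₄) / 2)) =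
      exp (I * x) * exp (I * θ₃ / 2) / (exp (I * θ₂ / 2) * exp (I * θ₄ / 2)) := by
    simp only [← exp_add, ← exp_sub]; ring_nf
  have c₃ : exp (I * (x + (θ₁ - θ₂ + θ₆) / 2)) =
      exp (I * x) * exp (I * θ₁ / 2) * exp (I * θ₆ / 2) / (exp (I * θ₂ / 2)) := by
    simp only [← exp_add, ← exp_sub]; ring_nf
  have c₄ : exp (I * (x + (θ₁ - θ₂ - θ₆) / 2)) =
      exp (I * x) * exp (I * θ₁ / 2) / (exp (I * θ₂ / 2) * exp (I * θ₆ / 2)) := by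
    simp only [← exp_add, ← exp_sub]; ring_nf
  rw [sin_eq_of_exp_eq s₁, sin_eq_of_exp_eq s₂, sin_eq_of_exp_eq s₃,
    sin_eq_of_exp_eq (t := x) rfl, cos_eq_of_exp_eq c₁, cos_eq_of_exp_eq c₂,
    cos_eq_of_exp_eq c₃, cos_eq_of_exp_eq c₄, hu₁, hu₂, hu₃, hu₄, hu₅, hu₆, hz,
    half_sq_x, half_sq θ₁, half_sq θ₂, half_sq θ₃, half_sq θ₄, half_sq θ₅, half_sq θ₆]
  have n₁ := exp_ne_zero (I * θ₁ / 2)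
  have n₂ := exp_ne_zero (I * θ₂ / 2)
  have n₃ := exp_ne_zero (I * θ₃ / 2)
  have n₄ := exp_ne_zero (I * θ₄ / 2)
  have n₅ := exp_ne_zero (I * θ₅ / 2)
  have n₆ := exp_ne_zero (I * θ₆ / 2)
  have nx := exp_ne_zero (I * x)
  generalize exp (I * θ₁ / 2) = v₁ at *
  generalize exp (I * θ₂ / 2) = v₂ at *
  generalize exp (I * θ₃ / 2) = v₃ at *
  generalize exp (I * θ₄ / 2) = v₄ at *
  generalize exp (I * θ₅ / 2) = v₅ at *
  generalize exp (I * θ₆ / 2) = v₆ at *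
  generalize exp (I * x) = w at *
  simp only [qA, qB, qC]
  field_simp
  simp only [I_pow_four]
  ring
end
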